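/- Let Φ ⊆ ℤⁿ be a finite set spanning ℤⁿ, Φ⁺ ⊆ Φ with Φ = Φ⁺ ∪ (−Φ⁺), and g : ℤⁿ → ℤⁿ a ℤ-linear bijection. Suppose x₁,…,xₙ ∈ Φ⁺ satisfy abs(g(xᵢ)) = eᵢ for all i. Then for every α ∈ Φ⁺, writing α = Σᵢ cᵢxᵢ with cᵢ ∈ ℤ (this expansion exists and is unique), we have (|c₁|,…,|cₙ|) = abs(g(α)). Consequently {(|c₁(α)|,…,|cₙ(α)|) : α ∈ Φ⁺} = {abs(g(α)) : α ∈ Φ⁺}. -/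

import Mathlib

/-- If each `g (x i)` is supported at `i`, then expanding `α` in the family `x` amounts to
reading off the coordinates of `g α`. -/
theorem eq_sum_smul_iff_of_apply_eq_zero {R M ι : Type*} [CommSemiring R] [AddCommMonoid M]
    [Module R M] [Fintype ι] (g : M ≃ₗ[R] (ι → R)) (x : ι → M)
    (hoff : ∀ i j, j ≠ i → g (x i) j = 0) (α : M) (c : ι → R) :
    α = ∑ i, c i • x i ↔ ∀ j, g α j = c j * g (x j) j := by
  have key (j : ι) : g (∑ i, c i • x i) j = c j * g (x j) j := by
    rw [map_sum, Finset.sum_apply, Finset.sum_eq_single j]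
    · simp
    · intro i _ hij
      simp [hoff i j hij.symm]
    · simp
  rw [← g.injective.eq_iff, funext_iff]
  simp only [key]

/-- The lattice-theoretic content of the main theorem: if abs(g(xᵢ)) = eᵢ for
x₁,…,xₙ ∈ Φ⁺, then every α ∈ Φ⁺ has a unique expansion α = Σ cᵢxᵢ, its vector
of absolute coefficients equals abs(g(α)), and the two associated sets agree. -/
theorem stmt15 (n : ℕ) (Φ Φpos : Set (Fin n → ℤ)) (hfin : Φ.Finite)
    (hspan : Submodule.span ℤ Φ = ⊤)
    (hpos : Φpos ⊆ Φ) (hcover : Φ = Φpos ∪ (-Φpos))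
    (g : (Fin n → ℤ) ≃ₗ[ℤ] (Fin n → ℤ))
    (x : Fin n → (Fin n → ℤ)) (hx : ∀ i, x i ∈ Φpos)
    (habs : ∀ i, (fun j => |g (x i) j|) = Pi.single i 1) :
    (∀ α ∈ Φpos, ∃! c : Fin n → ℤ, α = ∑ i, c i • x i) ∧
    (∀ α ∈ Φpos, ∀ c : Fin n → ℤ, α = ∑ i, c i • x i →
        (fun i => |c i|) = fun i => |g α i|) ∧
    {d : Fin n → ℤ | ∃ α ∈ Φpos, ∃ c : Fin n → ℤ,
        α = ∑ i, c i • x i ∧ d = fun i => |c i|}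
      = {d : Fin n → ℤ | ∃ α ∈ Φpos, d = fun i => |g α i|} := by
  have hdiag (i : Fin n) : |g (x i) i| = 1 := by simpa using congrFun (habs i) i
  have hoff (i j : Fin n) (hij : j ≠ i) : g (x i) j = 0 := by
    simpa [hij] using congrFun (habs i) j
  have hsq (i : Fin n) : g (x i) i * g (x i) i = 1 := by
    rw [← abs_mul_abs_self, hdiag, one_mul]
  have expand := eq_sum_smul_iff_of_apply_eq_zero g x hoff
  have unique_expansion (α : Fin n → ℤ) : ∃! c : Fin n → ℤ, α = ∑ i, c i • x i := by
    refine ⟨fun i => g α i * g (x i) i, (expand α _).2 fun j => ?_, fun c hc => ?_⟩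
    · rw [mul_assoc, hsq, mul_one]
    · funext j
      rw [(expand α c).1 hc j, mul_assoc, hsq, mul_one]
  have abs_coeff (α c : Fin n → ℤ) (hc : α = ∑ i, c i • x i) :
      (fun i => |c i|) = fun i => |g α i| := by
    funext j
    rw [(expand α c).1 hc j, abs_mul, hdiag, mul_one]
  refine ⟨fun α _ => unique_expansion α, fun α _ => abs_coeff α, Set.ext fun d => ⟨?_, ?_⟩⟩
  · rintro ⟨α, hα, c, hc, rfl⟩
    exact ⟨α, hα, abs_coeff α c hc⟩
  · rintro ⟨α, hα, rfl⟩
    obtain ⟨c, hc, -⟩ := unique_expansion α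
    exact ⟨α, hα, c, hc, (abs_coeff α c hc).symm⟩
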